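/- arXiv:1309.2000 — 2 statements merged into one kernel-verified Lean document; each statement's English description precedes it below -/
import Mathlib

section
/- There exist ε > 0 and a function ρ analytic on the disc {y : |y − 1| < ε} with ρ(1) = 1/(e−1) which satisfies the implicit equation 1 + ρ(y) = (1 + (e^{yρ(y)} − 1)/y) · ρ(y) · e^{1−ρ(y)} for all y with |y − 1| < ε. -/
open scoped Classical BigOperators
open Filter Topology

noncomputable section

namespace MetricDimPaper

/-- `R` is a resolving set of `G`: every pair of distinct vertices is distinguished by its
vector of (extended, possibly infinite) distances to the vertices of `R`. -/
def Resolves {V : Type*} (G : SimpleGraph V) (R : Set V) : Prop :=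
  ∀ u v : V, u ≠ v → ∃ w ∈ R, G.edist u w ≠ G.edist v w

/-- The metric dimension of a graph: the least cardinality of a resolving set, with the
convention that a single isolated vertex has metric dimension 1. -/
def metricDim {V : Type*} (G : SimpleGraph V) : ℕ :=
  if Nat.card V = 1 then 1
  else sInf {m : ℕ | ∃ R : Set V, R.ncard = m ∧ Resolves G R}

/-- A tree: a connected acyclic graph. -/
def IsTree {V : Type*} (G : SimpleGraph V) : Prop := G.Connected ∧ G.IsAcyclic

/-- degree of a vertex (as `Nat.card` of the neighbor set). -/
def ndeg {V : Type*} (G : SimpleGraph V) (v : V) : ℕ := (G.neighborSet v).ncard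

/-- metric dimension as a real number -/
def betaR {n : ℕ} (G : SimpleGraph (Fin n)) : ℝ := (metricDim G : ℝ)

def treeSet (n : ℕ) : Set (SimpleGraph (Fin n)) := {G | IsTree G}

def forestSet (n : ℕ) : Set (SimpleGraph (Fin n)) := {G | G.IsAcyclic}

/-- Expectation of `f` under the uniform distribution on the (finite) set `S` of graphs. -/
def unifExp {n : ℕ} (S : Set (SimpleGraph (Fin n))) (f : SimpleGraph (Fin n) → ℝ) : ℝ :=
  (∑ᶠ G ∈ S, f G) / (Nat.card ↥S)

/-- Variance of `f` under the uniform distribution on `S`. -/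
def unifVar {n : ℕ} (S : Set (SimpleGraph (Fin n))) (f : SimpleGraph (Fin n) → ℝ) : ℝ :=
  unifExp S (fun G => (f G - unifExp S f) ^ 2)

/-- Probability of the event `A` under the uniform distribution on `S`. -/
def unifPr {n : ℕ} (S A : Set (SimpleGraph (Fin n))) : ℝ :=
  (Nat.card ↥(S ∩ A) : ℝ) / (Nat.card ↥S)

/-- The probability weight of an individual graph in the Erdős–Rényi model `G(n,p)`. -/
def erWeight (n : ℕ) (p : ℝ) (G : SimpleGraph (Fin n)) : ℝ :=
  p ^ (Nat.card ↥G.edgeSet) * (1 - p) ^ (n.choose 2 - Nat.card ↥G.edgeSet)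

/-- Expectation of `f` in the Erdős–Rényi model `G(n,p)`. -/
def erExp (n : ℕ) (p : ℝ) (f : SimpleGraph (Fin n) → ℝ) : ℝ :=
  ∑ᶠ G : SimpleGraph (Fin n), erWeight n p G * f G

/-- Variance of `f` in the Erdős–Rényi model `G(n,p)`. -/
def erVar (n : ℕ) (p : ℝ) (f : SimpleGraph (Fin n) → ℝ) : ℝ :=
  erExp n p (fun G => (f G - erExp n p f) ^ 2)

/-- Probability of the event `A` in the Erdős–Rényi model `G(n,p)`. -/
def erPr (n : ℕ) (p : ℝ) (A : Set (SimpleGraph (Fin n))) : ℝ :=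
  ∑ᶠ G ∈ A, erWeight n p G

/-- The cumulative distribution function of the standard normal law. -/
def stdGaussianCDF (x : ℝ) : ℝ :=
  (Real.sqrt (2 * Real.pi))⁻¹ * ∫ t in Set.Iic x, Real.exp (-(t ^ 2) / 2)

/-- The normalized metric dimension `(β - E β)/sqrt (Var β)` for the uniform model on `S`. -/
def normβ {n : ℕ} (S : Set (SimpleGraph (Fin n))) (G : SimpleGraph (Fin n)) : ℝ :=
  (betaR G - unifExp S betaR) / Real.sqrt (unifVar S betaR)

/-- The normalized metric dimension `(β - E β)/sqrt (Var β)` for the `G(n,p)` model. -/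
def erNormβ (n : ℕ) (p : ℝ) (G : SimpleGraph (Fin n)) : ℝ :=
  (betaR G - erExp n p betaR) / Real.sqrt (erVar n p betaR)


/-- The analytic implicit function theorem for a scalar equation in two scalar variables. -/
lemma exists_analyticAt_implicit {f : ℂ × ℂ → ℂ} {a b d : ℂ} (hf : AnalyticAt ℂ f (a, b))
    (hd : HasDerivAt (fun r => f (a, r)) d b) (hd0 : d ≠ 0) :
    ∃ ψ : ℂ → ℂ, AnalyticAt ℂ ψ a ∧ ψ a = b ∧ ∀ᶠ y in 𝓝 a, f (y, ψ y) = f (a, b) := by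
  have hderiv : (fderiv ℂ f (a, b) ∘L .inr ℂ ℂ ℂ) 1 = d := by
    have hcomp := hf.differentiableAt.hasFDerivAt.comp_hasDerivAt b
      ((hasDerivAt_const b a).prodMk (hasDerivAt_id b))
    simpa using hcomp.unique hd
  have hinv : (fderiv ℂ f (a, b) ∘L .inr ℂ ℂ ℂ).IsInvertible := by
    refine ⟨ContinuousLinearEquiv.unitsEquivAut ℂ (Units.mk0 d hd0), ?_⟩
    ext
    simp [← hderiv]
  have hcont : ContDiffAt ℂ ⊤ f (a, b) := hf.contDiffAt
  exact ⟨hcont.implicitFunction (by simp) hinv,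
    (hcont.contDiffAt_implicitFunction (by simp) hinv).analyticAt,
    hcont.implicitFunction_apply_self (by simp) hinv,
    hcont.eventually_apply_implicitFunction (by simp) hinv⟩

/-- there exist `ε > 0` and a function `ρ` analytic on the disc
`{y : |y − 1| < ε}` with `ρ(1) = 1/(e−1)` satisfying
`1 + ρ(y) = (1 + (e^{yρ(y)} − 1)/y)·ρ(y)·e^{1−ρ(y)}` on that disc. -/
theorem rho_exists :
    ∃ ε : ℝ, 0 < ε ∧ ∃ ρ : ℂ → ℂ,
      AnalyticOnNhd ℂ ρ (Metric.ball 1 ε) ∧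
      ρ 1 = 1 / ((Real.exp 1 : ℂ) - 1) ∧
      ∀ y ∈ Metric.ball (1 : ℂ) ε,
        1 + ρ y = (1 + (Complex.exp (y * ρ y) - 1) / y) * ρ y * Complex.exp (1 - ρ y) := by
  have he : Complex.exp 1 - 1 ≠ 0 := by
    have h : Real.exp 1 - 1 ≠ 0 := (sub_pos.mpr (Real.one_lt_exp_iff.mpr one_pos)).ne'
    simpa only [Complex.ofReal_sub, Complex.ofReal_exp, Complex.ofReal_one] using
      Complex.ofReal_ne_zero.mpr h
  let f : ℂ × ℂ → ℂ := fun p =>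
    (1 + (Complex.exp (p.1 * p.2) - 1) / p.1) * p.2 * Complex.exp (1 - p.2) - (1 + p.2)
  have hslice (r : ℂ) : f (1, r) = (Complex.exp 1 - 1) * r - 1 := by
    have hexp : Complex.exp r * Complex.exp (1 - r) = Complex.exp 1 := by
      rw [← Complex.exp_add]; ring_nf
    simp only [f, one_mul, div_one]
    linear_combination r * hexp
  have hf : AnalyticAt ℂ f (1, 1 / (Complex.exp 1 - 1)) := by
    have hfst : AnalyticAt ℂ (fun p : ℂ × ℂ => p.1) (1, 1 / (Complex.exp 1 - 1)) := analyticAt_fst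
    have hsnd : AnalyticAt ℂ (fun p : ℂ × ℂ => p.2) (1, 1 / (Complex.exp 1 - 1)) := analyticAt_snd
    exact (((analyticAt_const.add (((hfst.mul hsnd).cexp.sub analyticAt_const).div hfst
      one_ne_zero)).mul hsnd).mul (analyticAt_const.sub hsnd).cexp).sub (analyticAt_const.add hsnd)
  have hd : HasDerivAt (fun r => f (1, r)) (Complex.exp 1 - 1) (1 / (Complex.exp 1 - 1)) := by
    simp only [hslice]
    simpa using ((hasDerivAt_id (1 / (Complex.exp 1 - 1))).const_mul (Complex.exp 1 - 1)).sub_const 1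
  have hzero : f (1, 1 / (Complex.exp 1 - 1)) = 0 := by
    rw [hslice, mul_one_div_cancel he, sub_self]
  obtain ⟨ρ, hρ, hρ1, hρeq⟩ := exists_analyticAt_implicit hf hd he
  obtain ⟨ε, hε, hball⟩ := Metric.eventually_nhds_iff_ball.mp
    (hρ.eventually_analyticAt.and hρeq)
  refine ⟨ε, hε, ρ, fun y hy => (hball y hy).1, by simpa using hρ1, fun y hy => ?_⟩
  exact (sub_eq_zero.mp ((hball y hy).2.trans hzero)).symm

end MetricDimPaper
end
end

section
/- Let ρ be the function analytic on a neighborhood of y = 1 with ρ(1) = 1/(e−1) satisfying 1 + ρ(y) = (1 + (e^{yρ(y)} − 1)/y) · ρ(y) · e^{1−ρ(y)}. For real y > 0, let P(·,y) be the power series in x whose coefficient of x^n/n! is Σ_M y^{(number of leaves of M) − (number of non-leaf vertices of M adjacent to a leaf)}, the sum ranging over all mobiles M with n vertices. Then there is ε > 0 such that for every real y with |y − 1| < ε, the radius of convergence of the power series P(·,y) equals ρ(y). -/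
open scoped Classical BigOperators
open Filter Topology

noncomputable section

namespace MetricDimPaper

/-- A mobile structure on the tree `T` with root `r` (the root is the vertex carrying the
distinguished half-edge, the leg, which counts towards its degree): no vertex has (mobile)
degree 2 and the leg is attached at a vertex which is not a leaf (the single vertex carrying
a leg being the allowed degenerate case). -/
def IsMobile {n : ℕ} (T : SimpleGraph (Fin n)) (r : Fin n) : Prop :=
  IsTree T ∧ (∀ v : Fin n, v ≠ r → ndeg T v ≠ 2) ∧ ndeg T r ≠ 1

/-- The degree of a vertex in a mobile: the leg counts towards the degree of the root. -/
def mobDeg {n : ℕ} (T : SimpleGraph (Fin n)) (r v : Fin n) : ℕ :=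
  if v = r then ndeg T v + 1 else ndeg T v

/-- The number of leaves (vertices of mobile-degree 1) of a mobile. -/
def mobLeaves {n : ℕ} (T : SimpleGraph (Fin n)) (r : Fin n) : ℕ :=
  Nat.card {v : Fin n // mobDeg T r v = 1}

/-- The number of non-leaf vertices of a mobile adjacent to at least one leaf. -/
def mobKCount {n : ℕ} (T : SimpleGraph (Fin n)) (r : Fin n) : ℕ :=
  Nat.card {w : Fin n // mobDeg T r w ≠ 1 ∧ ∃ v : Fin n, T.Adj w v ∧ mobDeg T r v = 1}

/-- The `n`-th coefficient of the exponential generating series `P(·,y)` of mobiles: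
`(∑_M y^(#leaves of M − #non-leaf vertices of M adjacent to a leaf))/n!`, the sum ranging
over all mobiles on `n` vertices. -/
def mobileCoeff (y : ℝ) (n : ℕ) : ℝ :=
  (∑ᶠ q : {q : SimpleGraph (Fin n) × Fin n // IsMobile q.1 q.2},
      y ^ ((mobLeaves q.1.1 q.1.2 : ℤ) - (mobKCount q.1.1 q.1.2 : ℤ))) /
    (Nat.factorial n : ℝ)

section Combinatorics

open scoped NNReal
open SimpleGraph

variable {V W : Type} [Fintype V] [Fintype W]

/-- The number of neighbours of a vertex, as a sum of indicators. -/
def nbrCount (T : SimpleGraph V) (v : V) : ℕ := ∑ w, if T.Adj v w then 1 else 0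

/-- The degree of `v` in the graph `T` with a leg attached at `r`. -/
def legDeg (T : SimpleGraph V) (r v : V) : ℕ := nbrCount T v + if v = r then 1 else 0

/-- The contribution of the vertex `v` to the weight of `T` rooted at `r`. -/
def vertexWt (y : ℝ≥0) (T : SimpleGraph V) (r v : V) : ℝ≥0 :=
  if legDeg T r v = 1 then y
  else if legDeg T r v = 2 then 0
  else if ∃ w, T.Adj v w ∧ legDeg T r w = 1 then y⁻¹
  else 1

/-- The number of neighbours of the root that are not leaves. -/
def innerCount (T : SimpleGraph V) (r : V) : ℕ :=
  ∑ w, if T.Adj r w ∧ legDeg T r w ≠ 1 then 1 else 0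

/-- The number of neighbours of the root that are leaves. -/
def leafCount (T : SimpleGraph V) (r : V) : ℕ :=
  ∑ w, if T.Adj r w ∧ legDeg T r w = 1 then 1 else 0

/-- The weight of all vertices but the root. -/
def branchWt (y : ℝ≥0) (T : SimpleGraph V) (r : V) : ℝ≥0 :=
  ∏ v, if v = r then 1 else vertexWt y T r v

/-- The weight of all vertices. -/
def fullWt (y : ℝ≥0) (T : SimpleGraph V) (r : V) : ℝ≥0 := ∏ v, vertexWt y T r v

theorem fullWt_eq_mul_branchWt (y : ℝ≥0) (T : SimpleGraph V) (r : V) :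
    fullWt y T r = vertexWt y T r r * branchWt y T r := by
  unfold fullWt branchWt
  rw [← Finset.mul_prod_erase _ _ (Finset.mem_univ r)]
  congr 1
  rw [← Finset.mul_prod_erase _ _ (Finset.mem_univ r)]
  simp only [if_true, one_mul]
  exact Finset.prod_congr rfl fun v hv => by simp [(Finset.mem_erase.1 hv).1]

section Comap

variable (e : V ≃ W) (T : SimpleGraph W)

theorem nbrCount_comap (v : V) : nbrCount (T.comap e) v = nbrCount T (e v) :=
  Fintype.sum_equiv e _ _ fun _ => rfl

theorem legDeg_comap (r v : V) : legDeg (T.comap e) r v = legDeg T (e r) (e v) := by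
  simp [legDeg, nbrCount_comap]

theorem vertexWt_comap (y : ℝ≥0) (r v : V) :
    vertexWt y (T.comap e) r v = vertexWt y T (e r) (e v) := by
  have h : (∃ w, (T.comap e).Adj v w ∧ legDeg (T.comap e) r w = 1) ↔
      ∃ w, T.Adj (e v) w ∧ legDeg T (e r) w = 1 := by
    rw [← e.exists_congr_right]
    simp [legDeg_comap]
  unfold vertexWt
  simp only [h]
  simp only [legDeg_comap]

theorem innerCount_comap (r : V) : innerCount (T.comap e) r = innerCount T (e r) :=
  Fintype.sum_equiv e _ _ fun _ => by simp [legDeg_comap]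

theorem leafCount_comap (r : V) : leafCount (T.comap e) r = leafCount T (e r) :=
  Fintype.sum_equiv e _ _ fun _ => by simp [legDeg_comap]

theorem branchWt_comap (y : ℝ≥0) (r : V) : branchWt y (T.comap e) r = branchWt y T (e r) :=
  Fintype.prod_equiv e _ _ fun _ => by simp [vertexWt_comap]

theorem fullWt_comap (y : ℝ≥0) (r : V) : fullWt y (T.comap e) r = fullWt y T (e r) :=
  Fintype.prod_equiv e _ _ fun _ => by simp [vertexWt_comap]

omit [Fintype V] [Fintype W] in
theorem isTree_comap : (T.comap e).IsTree ↔ T.IsTree :=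
  (Iso.comap e T).isTree_iff

end Comap

/-- Join two disjoint graphs by the single edge between `a` and `b`. -/
def glue (A : SimpleGraph V) (a : V) (B : SimpleGraph W) (b : W) : SimpleGraph (V ⊕ W) where
  Adj
    | .inl u, .inl v => A.Adj u v
    | .inr u, .inr v => B.Adj u v
    | .inl u, .inr v => u = a ∧ v = b
    | .inr v, .inl u => u = a ∧ v = b
  symm := ⟨by
    rintro (u | u) (v | v) h
    · exact A.adj_symm h
    · exact h
    · exact h
    · exact B.adj_symm h⟩
  loopless := ⟨by
    rintro (u | u) h
    · exact A.loopless.irrefl u h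
    · exact B.loopless.irrefl u h⟩

section Glue

variable (A : SimpleGraph V) (a : V) (B : SimpleGraph W) (b : W)

omit [Fintype V] [Fintype W] in
@[simp] theorem glue_inl_inl (u v : V) : (glue A a B b).Adj (.inl u) (.inl v) ↔ A.Adj u v := Iff.rfl

omit [Fintype V] [Fintype W] in
@[simp] theorem glue_inr_inr (u v : W) : (glue A a B b).Adj (.inr u) (.inr v) ↔ B.Adj u v := Iff.rfl

omit [Fintype V] [Fintype W] in
@[simp] theorem glue_inl_inr (u : V) (v : W) :
    (glue A a B b).Adj (.inl u) (.inr v) ↔ u = a ∧ v = b := Iff.rfl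

omit [Fintype V] [Fintype W] in
@[simp] theorem glue_inr_inl (u : V) (v : W) :
    (glue A a B b).Adj (.inr v) (.inl u) ↔ u = a ∧ v = b := Iff.rfl

theorem nbrCount_glue_inl (v : V) :
    nbrCount (glue A a B b) (.inl v) = nbrCount A v + if v = a then 1 else 0 := by
  simp only [nbrCount, Fintype.sum_sum_type, glue_inl_inl, glue_inl_inr]
  by_cases h : v = a <;> simp [h]

theorem nbrCount_glue_inr (v : W) :
    nbrCount (glue A a B b) (.inr v) = nbrCount B v + if v = b then 1 else 0 := by
  simp only [nbrCount, Fintype.sum_sum_type, glue_inr_inl, glue_inr_inr]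
  by_cases h : v = b <;> simp [h, add_comm]

theorem legDeg_glue_inl (v : V) :
    legDeg (glue A a B b) (.inr b) (.inl v) = legDeg A a v := by
  simp [legDeg, nbrCount_glue_inl]

theorem legDeg_glue_inr (v : W) :
    legDeg (glue A a B b) (.inr b) (.inr v) = legDeg B b v + if v = b then 1 else 0 := by
  simp [legDeg, nbrCount_glue_inr]

theorem legDeg_glue_root_ne_one : legDeg (glue A a B b) (.inr b) (.inr b) ≠ 1 := by
  simp [legDeg, nbrCount_glue_inr]

theorem legDeg_root_ne_one_of_adj {v : V} (h : A.Adj v a) : legDeg A a a ≠ 1 := by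
  have : 0 < nbrCount A a :=
    Finset.sum_pos' (fun _ _ => Nat.zero_le _) ⟨v, Finset.mem_univ v, by simp [h.symm]⟩
  simp [legDeg]
  lia

theorem vertexWt_glue_inl (y : ℝ≥0) (v : V) :
    vertexWt y (glue A a B b) (.inr b) (.inl v) = vertexWt y A a v := by
  have h : (∃ w, (glue A a B b).Adj (.inl v) w ∧ legDeg (glue A a B b) (.inr b) w = 1) ↔
      ∃ w, A.Adj v w ∧ legDeg A a w = 1 := by
    simp only [Sum.exists, glue_inl_inl, legDeg_glue_inl, glue_inl_inr]
    refine or_iff_left ?_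
    rintro ⟨w, ⟨-, rfl⟩, hw⟩
    exact legDeg_glue_root_ne_one A a B w hw
  simp only [vertexWt, legDeg_glue_inl, h]

theorem vertexWt_glue_inr (y : ℝ≥0) (v : W) (hv : v ≠ b) :
    vertexWt y (glue A a B b) (.inr b) (.inr v) = vertexWt y B b v := by
  have h : (∃ w, (glue A a B b).Adj (.inr v) w ∧ legDeg (glue A a B b) (.inr b) w = 1) ↔
      ∃ w, B.Adj v w ∧ legDeg B b w = 1 := by
    simp only [Sum.exists, glue_inr_inl, glue_inr_inr, hv, and_false, false_and, exists_false,
      false_or]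
    refine exists_congr fun w => and_congr_right fun hw => ?_
    by_cases hwb : w = b
    · subst hwb
      simp [legDeg_glue_root_ne_one, legDeg_root_ne_one_of_adj B w hw]
    · simp [legDeg_glue_inr, hwb]
  simp only [vertexWt, legDeg_glue_inr, hv, if_false, add_zero, h]

theorem branchWt_glue (y : ℝ≥0) :
    branchWt y (glue A a B b) (.inr b) = fullWt y A a * branchWt y B b := by
  simp only [branchWt, fullWt, Fintype.prod_sum_type, vertexWt_glue_inl, reduceCtorEq, if_false,
    Sum.inr.injEq]
  congr 1
  refine Finset.prod_congr rfl fun v _ => ?_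
  split_ifs with h
  · rfl
  · exact vertexWt_glue_inr A a B b y v h

theorem innerCount_glue :
    innerCount (glue A a B b) (.inr b) =
      innerCount B b + if legDeg A a a ≠ 1 then 1 else 0 := by
  simp only [innerCount, Fintype.sum_sum_type, glue_inr_inl, glue_inr_inr, legDeg_glue_inl]
  rw [add_comm]
  congr 1
  · refine Finset.sum_congr rfl fun v _ => ?_
    by_cases h : v = b
    · simp [h]
    · simp [h, legDeg_glue_inr]
  · rw [Finset.sum_eq_single a] <;> simp +contextual

theorem leafCount_glue :
    leafCount (glue A a B b) (.inr b) =
      leafCount B b + if legDeg A a a = 1 then 1 else 0 := by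
  simp only [leafCount, Fintype.sum_sum_type, glue_inr_inl, glue_inr_inr, legDeg_glue_inl]
  rw [add_comm]
  congr 1
  · refine Finset.sum_congr rfl fun v _ => ?_
    by_cases h : v = b
    · simp [h]
    · simp [h, legDeg_glue_inr]
  · rw [Finset.sum_eq_single a] <;> simp +contextual

theorem sum_nbrCount (T : SimpleGraph V) : ∑ v, nbrCount T v = 2 * Nat.card T.edgeSet := by
  have h : ∀ v, nbrCount T v = T.degree v := fun v => by
    simp [nbrCount, Finset.sum_boole, ← T.card_neighborFinset_eq_degree,
      neighborFinset_eq_filter]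
  simp only [h, sum_degrees_eq_twice_card_edges, edgeFinset_card, Nat.card_eq_fintype_card]

variable {A B}

theorem isTree_glue (hA : A.IsTree) (hB : B.IsTree) : (glue A a B b).IsTree := by
  rw [isTree_iff_connected_and_card] at hA hB ⊢
  refine ⟨?_, ?_⟩
  · rw [connected_iff_exists_forall_reachable]
    have hl : ∀ v, (glue A a B b).Reachable (.inl a) (.inl v) := fun v =>
      (hA.1.preconnected a v).map (⟨Sum.inl, fun h => h⟩ : A →g glue A a B b)
    have hr : ∀ v, (glue A a B b).Reachable (.inr b) (.inr v) := fun v =>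
      (hB.1.preconnected b v).map (⟨Sum.inr, fun h => h⟩ : B →g glue A a B b)
    refine ⟨.inl a, ?_⟩
    rintro (v | v)
    · exact hl v
    · have hab : (glue A a B b).Adj (.inl a) (.inr b) := ⟨rfl, rfl⟩
      exact hab.reachable.trans (hr v)
  · have h := sum_nbrCount (glue A a B b)
    rw [Fintype.sum_sum_type] at h
    simp only [nbrCount_glue_inl, nbrCount_glue_inr, Finset.sum_add_distrib, Finset.sum_ite_eq',
      Finset.mem_univ, if_true] at h
    rw [sum_nbrCount, sum_nbrCount] at h
    have hc : Nat.card (V ⊕ W) = Nat.card V + Nat.card W := Nat.card_sum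
    lia

end Glue

section Cut

/-- The only edge of `T` between `S` and its complement joins `c ∈ S` to `r ∉ S`. -/
structure Splits (T : SimpleGraph V) (r c : V) (S : Finset V) : Prop where
  notMem : r ∉ S
  mem : c ∈ S
  adj_iff : ∀ u ∈ S, ∀ v ∉ S, T.Adj u v ↔ u = c ∧ v = r

variable {T : SimpleGraph V} {r c : V} {S S' : Finset V}

omit [Fintype V] in
theorem Splits.subset (h : Splits T r c S) (h' : Splits T r c S')
    (hS : (T.comap ((↑) : {v // v ∈ S} → V)).Connected) : S ⊆ S' := by
  intro v hv
  have hreach := hS.preconnected ⟨c, h.mem⟩ ⟨v, hv⟩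
  rw [reachable_iff_reflTransGen] at hreach
  suffices ∀ w : {v // v ∈ S},
      Relation.ReflTransGen (T.comap ((↑) : {v // v ∈ S} → V)).Adj ⟨c, h.mem⟩ w → (w : V) ∈ S' from
    this _ hreach
  intro w hw
  induction hw with
  | refl => exact h'.mem
  | @tail u w _ huw ih =>
    by_contra hwS
    have := ((h'.adj_iff _ ih _ hwS).1 huw).2
    exact h.notMem (this ▸ w.2)

omit [Fintype V] in
theorem Splits.eq (h : Splits T r c S) (h' : Splits T r c S')
    (hS : (T.comap ((↑) : {v // v ∈ S} → V)).Connected)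
    (hS' : (T.comap ((↑) : {v // v ∈ S'} → V)).Connected) : S = S' :=
  (h.subset h' hS).antisymm (h'.subset h hS')

theorem exists_splits (hT : T.IsTree) (h : T.Adj r c) : ∃ S, Splits T r c S := by
  have hb := isAcyclic_iff_forall_adj_isBridge.1 hT.isAcyclic h
  rw [isBridge_iff] at hb
  refine ⟨Finset.univ.filter fun v => (T.deleteEdges {s(r, c)}).Reachable c v, ?_, ?_, ?_⟩
  · simpa [reachable_comm] using hb
  · simp
  · intro u hu v hv
    simp only [Finset.mem_filter, Finset.mem_univ, true_and] at hu hv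
    refine ⟨fun huv => ?_, ?_⟩
    · by_cases he : s(u, v) = s(r, c)
      · rcases Sym2.eq_iff.1 he with ⟨rfl, rfl⟩ | ⟨rfl, rfl⟩
        · exact absurd hu.symm hb
        · exact ⟨rfl, rfl⟩
      · refine absurd (hu.trans (Adj.reachable ?_)) hv
        simpa [deleteEdges_adj, huv] using he
    · rintro ⟨rfl, rfl⟩
      exact h.symm

omit [Fintype V] in
theorem Splits.isTree_mem (h : Splits T r c S) (hT : T.IsTree) :
    (T.comap ((↑) : {v // v ∈ S} → V)).IsTree := by
  refine ⟨(connected_iff _).2 ⟨?_, ⟨⟨c, h.mem⟩⟩⟩, hT.isAcyclic.of_comap ⟨_, Subtype.val_injective⟩⟩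
  let col : V → {v // v ∈ S} := fun v => if hv : v ∈ S then ⟨v, hv⟩ else ⟨c, h.mem⟩
  have key : ∀ u v, Relation.ReflTransGen T.Adj u v →
      (T.comap ((↑) : {v // v ∈ S} → V)).Reachable (col u) (col v) := by
    intro u v huv
    induction huv with
    | refl => exact Reachable.refl _
    | @tail v w _ hvw ih =>
      refine ih.trans ?_
      by_cases hv : v ∈ S <;> by_cases hw : w ∈ S
      · simp only [col, hv, hw, dif_pos]
        exact Adj.reachable hvw
      · obtain ⟨rfl, rfl⟩ := (h.adj_iff v hv w hw).1 hvw
        simp [col, hv, hw]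
      · obtain ⟨rfl, rfl⟩ := (h.adj_iff w hw v hv).1 hvw.symm
        simp [col, hv, hw]
      · simp [col, hv, hw]
  intro u v
  have := key u v ((reachable_iff_reflTransGen _ _).1 (hT.connected.preconnected _ _))
  simpa [col] using this

omit [Fintype V] in
theorem Splits.isTree_notMem (h : Splits T r c S) (hT : T.IsTree) :
    (T.comap ((↑) : {v // v ∉ S} → V)).IsTree := by
  refine ⟨(connected_iff _).2 ⟨?_, ⟨⟨r, h.notMem⟩⟩⟩,
    hT.isAcyclic.of_comap ⟨_, Subtype.val_injective⟩⟩
  let col : V → {v // v ∉ S} := fun v => if hv : v ∉ S then ⟨v, hv⟩ else ⟨r, h.notMem⟩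
  have key : ∀ u v, Relation.ReflTransGen T.Adj u v →
      (T.comap ((↑) : {v // v ∉ S} → V)).Reachable (col u) (col v) := by
    intro u v huv
    induction huv with
    | refl => exact Reachable.refl _
    | @tail v w _ hvw ih =>
      refine ih.trans ?_
      by_cases hv : v ∈ S <;> by_cases hw : w ∈ S
      · simp [col, hv, hw]
      · obtain ⟨rfl, rfl⟩ := (h.adj_iff v hv w hw).1 hvw
        simp [col, hv, hw]
      · obtain ⟨rfl, rfl⟩ := (h.adj_iff w hw v hv).1 hvw.symm
        simp [col, hv, hw]
      · simp only [col, hv, hw, not_false_eq_true, dif_pos]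
        exact Adj.reachable hvw
  intro u v
  have := key u v ((reachable_iff_reflTransGen _ _).1 (hT.connected.preconnected _ _))
  simpa [col, u.2, v.2] using this

/-- Glue two rooted graphs on complementary vertex sets. -/
def glueOn (S : Finset V) (A : SimpleGraph {v // v ∈ S}) (a : {v // v ∈ S})
    (B : SimpleGraph {v // v ∉ S}) (b : {v // v ∉ S}) : SimpleGraph V :=
  (glue A a B b).comap (Equiv.sumCompl (· ∈ S)).symm

section

variable (S) (A : SimpleGraph {v // v ∈ S}) (a : {v // v ∈ S})
    (B : SimpleGraph {v // v ∉ S}) (b : {v // v ∉ S})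

omit [Fintype V] in
theorem glueOn_comap_mem : (glueOn S A a B b).comap ((↑) : {v // v ∈ S} → V) = A := by
  ext u v
  simp [glueOn]

omit [Fintype V] in
theorem glueOn_comap_notMem : (glueOn S A a B b).comap ((↑) : {v // v ∉ S} → V) = B := by
  ext u v
  simp [glueOn]

omit [Fintype V] in
theorem splits_glueOn : Splits (glueOn S A a B b) b a S where
  notMem := b.2
  mem := a.2
  adj_iff u hu v hv := by
    simp [glueOn, Equiv.sumCompl_symm_apply_of_pos hu, Equiv.sumCompl_symm_apply_of_neg hv,
      Subtype.ext_iff]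

end

omit [Fintype V] in
theorem Splits.glueOn_comap (h : Splits T r c S) :
    glueOn S (T.comap (↑)) ⟨c, h.mem⟩ (T.comap (↑)) ⟨r, h.notMem⟩ = T := by
  ext u v
  by_cases hu : u ∈ S <;> by_cases hv : v ∈ S
  · simp [glueOn, Equiv.sumCompl_symm_apply_of_pos hu, Equiv.sumCompl_symm_apply_of_pos hv]
  · simp [glueOn, Equiv.sumCompl_symm_apply_of_pos hu, Equiv.sumCompl_symm_apply_of_neg hv,
      h.adj_iff u hu v hv]
  · simp [glueOn, Equiv.sumCompl_symm_apply_of_neg hu, Equiv.sumCompl_symm_apply_of_pos hv,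
      T.adj_comm u v, h.adj_iff v hv u hu]
  · simp [glueOn, Equiv.sumCompl_symm_apply_of_neg hu, Equiv.sumCompl_symm_apply_of_neg hv]

/-- Summing over trees with a distinguished edge at the root is summing over pairs of rooted trees
on complementary vertex sets. -/
theorem sum_cut (F : SimpleGraph V → V → V → ℝ≥0) :
    ∑ q : SimpleGraph V × V × V,
        (if q.1.IsTree ∧ q.1.Adj q.2.1 q.2.2 then F q.1 q.2.1 q.2.2 else 0) =
      ∑ S : Finset V, ∑ A : SimpleGraph {v // v ∈ S} × {v // v ∈ S},
        ∑ B : SimpleGraph {v // v ∉ S} × {v // v ∉ S},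
          if A.1.IsTree ∧ B.1.IsTree then F (glueOn S A.1 A.2 B.1 B.2) B.2 A.2 else 0 := by
  simp_rw [← Fintype.sum_prod_type']
  rw [← Fintype.sum_sigma' (α := fun S : Finset V =>
    (SimpleGraph {v // v ∈ S} × {v // v ∈ S}) × (SimpleGraph {v // v ∉ S} × {v // v ∉ S}))
    (fun S x => if x.1.1.IsTree ∧ x.2.1.IsTree then
      F (glueOn S x.1.1 x.1.2 x.2.1 x.2.2) x.2.2 x.1.2 else 0)]
  rw [← Finset.sum_filter, ← Finset.sum_filter]
  symm
  refine Finset.sum_bij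
    (fun x _ => (glueOn x.1 x.2.1.1 x.2.1.2 x.2.2.1 x.2.2.2, (x.2.2.2 : V), (x.2.1.2 : V)))
    ?_ ?_ ?_ ?_
  · rintro ⟨S, ⟨A, a⟩, ⟨B, b⟩⟩ hx
    simp only [Finset.mem_filter, Finset.mem_univ, true_and] at hx ⊢
    exact ⟨(isTree_comap _ _).2 (isTree_glue a b hx.1 hx.2),
      (((splits_glueOn S A a B b).adj_iff _ a.2 _ b.2).2 ⟨rfl, rfl⟩).symm⟩
  · rintro ⟨S, ⟨A, a⟩, ⟨B, b⟩⟩ hx ⟨S', ⟨A', a'⟩, ⟨B', b'⟩⟩ hx' heq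
    simp only [Finset.mem_filter, Finset.mem_univ, true_and, Prod.mk.injEq] at hx hx' heq
    obtain ⟨h1, h2, h3⟩ := heq
    have hs := splits_glueOn S A a B b
    have hs' := splits_glueOn S' A' a' B' b'
    rw [← h1, ← h2, ← h3] at hs'
    have hSS' : S = S' := hs.eq hs' (by rw [glueOn_comap_mem]; exact hx.1.connected)
      (by rw [h1, glueOn_comap_mem]; exact hx'.1.connected)
    subst hSS'
    obtain rfl := Subtype.ext h2
    obtain rfl := Subtype.ext h3
    have hA := glueOn_comap_mem S A a B b
    have hB := glueOn_comap_notMem S A a B b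
    rw [h1, glueOn_comap_mem] at hA
    rw [h1, glueOn_comap_notMem] at hB
    subst hA hB
    rfl
  · rintro ⟨T, r, c⟩ hq
    simp only [Finset.mem_filter, Finset.mem_univ, true_and] at hq
    obtain ⟨S, hS⟩ := exists_splits hq.1 hq.2
    refine ⟨⟨S, (T.comap (↑), ⟨c, hS.mem⟩), (T.comap (↑), ⟨r, hS.notMem⟩)⟩, ?_, ?_⟩
    · simp only [Finset.mem_filter, Finset.mem_univ, true_and]
      exact ⟨hS.isTree_mem hq.1, hS.isTree_notMem hq.1⟩
    · simp [hS.glueOn_comap]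
  · intro x _
    rfl

end Cut

/-- The total weight of the non-root vertices over all rooted trees on `V` whose root has `k`
neighbours that are not leaves and `l` neighbours that are leaves. -/
def branchSum (y : ℝ≥0) (k l : ℕ) (V : Type) [Fintype V] : ℝ≥0 :=
  ∑ q : SimpleGraph V × V,
    if q.1.IsTree ∧ innerCount q.1 q.2 = k ∧ leafCount q.1 q.2 = l then branchWt y q.1 q.2 else 0

/-- The total weight of the rooted trees on `V` whose root is not a leaf. -/
def innerSum (y : ℝ≥0) (V : Type) [Fintype V] : ℝ≥0 :=
  ∑ q : SimpleGraph V × V,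
    if q.1.IsTree ∧ legDeg q.1 q.2 q.2 ≠ 1 then fullWt y q.1 q.2 else 0

/-- The total weight of the rooted trees on `V` whose root is a leaf. -/
def leafSum (y : ℝ≥0) (V : Type) [Fintype V] : ℝ≥0 :=
  ∑ q : SimpleGraph V × V,
    if q.1.IsTree ∧ legDeg q.1 q.2 q.2 = 1 then fullWt y q.1 q.2 else 0

theorem sum_simpleGraph_congr (e : V ≃ W) (f : SimpleGraph V × V → ℝ≥0)
    (g : SimpleGraph W × W → ℝ≥0) (h : ∀ (T : SimpleGraph W) r, f (T.comap e, r) = g (T, e r)) :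
    ∑ q, f q = ∑ q, g q := by
  refine (Fintype.sum_equiv (e.symm.simpleGraph.prodCongr e.symm) _ _ ?_).symm
  rintro ⟨T, r⟩
  have := h T (e.symm r)
  rw [e.apply_symm_apply] at this
  exact this.symm

theorem branchSum_congr (y : ℝ≥0) (k l : ℕ) (e : V ≃ W) : branchSum y k l V = branchSum y k l W :=
  sum_simpleGraph_congr e _ _ fun T r => by
    simp [isTree_comap, innerCount_comap, leafCount_comap, branchWt_comap]

theorem innerSum_congr (y : ℝ≥0) (e : V ≃ W) : innerSum y V = innerSum y W :=
  sum_simpleGraph_congr e _ _ fun T r => by simp [isTree_comap, legDeg_comap, fullWt_comap]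

theorem leafSum_congr (y : ℝ≥0) (e : V ≃ W) : leafSum y V = leafSum y W :=
  sum_simpleGraph_congr e _ _ fun T r => by simp [isTree_comap, legDeg_comap, fullWt_comap]

section GlueOn

variable (S : Finset V) (A : SimpleGraph {v // v ∈ S}) (a : {v // v ∈ S})
    (B : SimpleGraph {v // v ∉ S}) (b : {v // v ∉ S})

theorem branchWt_glueOn (y : ℝ≥0) :
    branchWt y (glueOn S A a B b) b = fullWt y A a * branchWt y B b := by
  rw [glueOn, branchWt_comap, Equiv.sumCompl_symm_apply_neg, branchWt_glue]

theorem innerCount_glueOn :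
    innerCount (glueOn S A a B b) b = innerCount B b + if legDeg A a a ≠ 1 then 1 else 0 := by
  rw [glueOn, innerCount_comap, Equiv.sumCompl_symm_apply_neg, innerCount_glue]

theorem leafCount_glueOn :
    leafCount (glueOn S A a B b) b = leafCount B b + if legDeg A a a = 1 then 1 else 0 := by
  rw [glueOn, leafCount_comap, Equiv.sumCompl_symm_apply_neg, leafCount_glue]

theorem legDeg_glueOn : legDeg (glueOn S A a B b) b a = legDeg A a a := by
  rw [glueOn, legDeg_comap, Equiv.sumCompl_symm_apply_neg, Equiv.sumCompl_symm_apply_pos,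
    legDeg_glue_inl]

end GlueOn

theorem succ_mul_branchSum_inner (y : ℝ≥0) (k l : ℕ) :
    (k + 1) * branchSum y (k + 1) l V =
      ∑ S : Finset V, innerSum y {v // v ∈ S} * branchSum y k l {v // v ∉ S} := by
  have h := sum_cut (V := V) fun T r c =>
    if (innerCount T r = k + 1 ∧ leafCount T r = l) ∧ legDeg T r c ≠ 1 then branchWt y T r else 0
  convert h using 1
  · rw [branchSum, Finset.mul_sum]
    simp_rw [Fintype.sum_prod_type]
    refine Finset.sum_congr rfl fun T _ => Finset.sum_congr rfl fun r _ => ?_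
    by_cases hT : T.IsTree <;> by_cases hi : innerCount T r = k + 1 <;>
      by_cases hl : leafCount T r = l <;> simp only [hT, hi, hl, true_and, false_and, and_false,
        if_true, if_false, mul_zero, Finset.sum_const_zero, ite_self]
    rw [show ((k : ℝ≥0) + 1) = (innerCount T r : ℕ) by simp [hi], innerCount, Nat.cast_sum,
      Finset.sum_mul]
    refine Finset.sum_congr rfl fun c _ => ?_
    by_cases h1 : T.Adj r c <;> by_cases h2 : legDeg T r c = 1 <;> simp [h1, h2]
  · refine Finset.sum_congr rfl fun S _ => ?_
    rw [innerSum, branchSum, Finset.sum_mul_sum]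
    refine Finset.sum_congr (by ext; simp) fun A _ => Finset.sum_congr (by ext; simp) fun B _ => ?_
    rw [branchWt_glueOn, innerCount_glueOn, leafCount_glueOn, legDeg_glueOn]
    by_cases h1 : A.1.IsTree <;> by_cases h2 : B.1.IsTree <;>
      by_cases h3 : legDeg A.1 A.2 A.2 = 1 <;> simp [h1, h2, h3]

theorem succ_mul_branchSum_leaf (y : ℝ≥0) (k l : ℕ) :
    (l + 1) * branchSum y k (l + 1) V =
      ∑ S : Finset V, leafSum y {v // v ∈ S} * branchSum y k l {v // v ∉ S} := by
  have h := sum_cut (V := V) fun T r c =>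
    if (innerCount T r = k ∧ leafCount T r = l + 1) ∧ legDeg T r c = 1 then branchWt y T r else 0
  convert h using 1
  · rw [branchSum, Finset.mul_sum]
    simp_rw [Fintype.sum_prod_type]
    refine Finset.sum_congr rfl fun T _ => Finset.sum_congr rfl fun r _ => ?_
    by_cases hT : T.IsTree <;> by_cases hi : innerCount T r = k <;>
      by_cases hl : leafCount T r = l + 1 <;> simp only [hT, hi, hl, true_and, false_and, and_false,
        if_true, if_false, mul_zero, Finset.sum_const_zero, ite_self]
    rw [show ((l : ℝ≥0) + 1) = (leafCount T r : ℕ) by simp [hl], leafCount, Nat.cast_sum,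
      Finset.sum_mul]
    refine Finset.sum_congr rfl fun c _ => ?_
    by_cases h1 : T.Adj r c <;> by_cases h2 : legDeg T r c = 1 <;> simp [h1, h2]
  · refine Finset.sum_congr rfl fun S _ => ?_
    rw [leafSum, branchSum, Finset.sum_mul_sum]
    refine Finset.sum_congr (by ext; simp) fun A _ => Finset.sum_congr (by ext; simp) fun B _ => ?_
    rw [branchWt_glueOn, innerCount_glueOn, leafCount_glueOn, legDeg_glueOn]
    by_cases h1 : A.1.IsTree <;> by_cases h2 : B.1.IsTree <;>
      by_cases h3 : legDeg A.1 A.2 A.2 = 1 <;> simp [h1, h2, h3]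

theorem nbrCount_eq_innerCount_add_leafCount (T : SimpleGraph V) (r : V) :
    nbrCount T r = innerCount T r + leafCount T r := by
  rw [nbrCount, innerCount, leafCount, ← Finset.sum_add_distrib]
  refine Finset.sum_congr rfl fun w _ => ?_
  by_cases h1 : T.Adj r w <;> by_cases h2 : legDeg T r w = 1 <;> simp [h1, h2]

theorem card_eq_one_of_nbrCount_eq_zero {T : SimpleGraph V} (hT : T.IsTree) {r : V}
    (h : nbrCount T r = 0) : Fintype.card V = 1 := by
  refine Fintype.card_eq_one_iff.2 ⟨r, fun v => ?_⟩
  have hr := (reachable_iff_reflTransGen _ _).1 (hT.connected.preconnected r v)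
  rcases hr.cases_head with rfl | ⟨w, hw, -⟩
  · rfl
  · have := Finset.sum_eq_zero_iff.1 h w (Finset.mem_univ w)
    simp [hw] at this

theorem leafSum_fin (y : ℝ≥0) (n : ℕ) : leafSum y (Fin n) = if n = 1 then y else 0 := by
  split_ifs with hn
  · subst hn
    rw [leafSum, Finset.sum_eq_single ((⊥ : SimpleGraph (Fin 1)), (0 : Fin 1))
      (fun q _ hq => absurd (Subsingleton.elim _ _) hq) (by simp)]
    simp [IsTree.of_subsingleton, legDeg, nbrCount, fullWt, vertexWt]
  · refine Finset.sum_eq_zero fun q _ => if_neg ?_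
    rintro ⟨hT, hq⟩
    have h0 : nbrCount q.1 q.2 = 0 := by simpa [legDeg] using hq
    exact hn (by simpa using card_eq_one_of_nbrCount_eq_zero hT h0)

theorem branchSum_zero_zero_fin (y : ℝ≥0) (n : ℕ) :
    branchSum y 0 0 (Fin n) = if n = 1 then 1 else 0 := by
  split_ifs with hn
  · subst hn
    rw [branchSum, Finset.sum_eq_single ((⊥ : SimpleGraph (Fin 1)), (0 : Fin 1))
      (fun q _ hq => absurd (Subsingleton.elim _ _) hq) (by simp)]
    simp [IsTree.of_subsingleton, innerCount, leafCount, branchWt]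
  · refine Finset.sum_eq_zero fun q _ => if_neg ?_
    rintro ⟨hT, hq, hq'⟩
    have h0 : nbrCount q.1 q.2 = 0 := by simp [nbrCount_eq_innerCount_add_leafCount, hq, hq']
    exact hn (by simpa using card_eq_one_of_nbrCount_eq_zero hT h0)

/-- The weight of a root having `k` neighbours that are not leaves and `l` that are leaves, if
the root itself is not a leaf. -/
def rootWt (y : ℝ≥0) (k l : ℕ) : ℝ≥0 :=
  if k + l ≤ 1 then 0 else if l = 0 then 1 else y⁻¹

theorem vertexWt_root (y : ℝ≥0) {T : SimpleGraph V} {r : V} (h : legDeg T r r ≠ 1) :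
    vertexWt y T r r = rootWt y (innerCount T r) (leafCount T r) := by
  have hd : legDeg T r r = innerCount T r + leafCount T r + 1 := by
    simp [legDeg, nbrCount_eq_innerCount_add_leafCount]
  have hl : (∃ w, T.Adj r w ∧ legDeg T r w = 1) ↔ ¬ leafCount T r = 0 := by
    simp [leafCount]
  have h2 : legDeg T r r = 2 ↔ innerCount T r + leafCount T r ≤ 1 := by lia
  simp only [vertexWt, h, if_false, h2, hl, rootWt, ite_not]

open scoped ENNReal in
theorem innerSum_eq_tsum (y : ℝ≥0) :
    (innerSum y V : ℝ≥0∞) = ∑' p : ℕ × ℕ, (rootWt y p.1 p.2 : ℝ≥0∞) * branchSum y p.1 p.2 V := by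
  simp only [innerSum, branchSum, ENNReal.ofNNReal_finsetSum, Finset.mul_sum]
  rw [Summable.tsum_finsetSum fun _ _ => ENNReal.summable]
  refine Finset.sum_congr rfl fun q _ => ?_
  rw [tsum_eq_single (innerCount q.1 q.2, leafCount q.1 q.2)]
  · by_cases hT : q.1.IsTree <;> by_cases h : legDeg q.1 q.2 q.2 = 1
    · have : innerCount q.1 q.2 + leafCount q.1 q.2 = 0 := by
        simpa [legDeg, nbrCount_eq_innerCount_add_leafCount] using h
      simp [h, rootWt, this]
    · simp [hT, h, fullWt_eq_mul_branchWt, vertexWt_root]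
    · simp [hT]
    · simp [hT]
  · intro p hp
    rw [if_neg, ENNReal.coe_zero, mul_zero]
    rintro ⟨-, h1, h2⟩
    exact hp (by rw [h1, h2])

/-- The exponential generating coefficients of `branchSum`. -/
def branchCoeff (y : ℝ≥0) (k l n : ℕ) : ℝ≥0 := branchSum y k l (Fin n) / n.factorial

/-- The exponential generating coefficients of `innerSum`. -/
def innerCoeff (y : ℝ≥0) (n : ℕ) : ℝ≥0 := innerSum y (Fin n) / n.factorial

theorem sum_finset_div_factorial (f g : ℕ → ℝ≥0) (n : ℕ) :
    (∑ S : Finset (Fin n), f S.card * g (n - S.card)) / n.factorial =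
      ∑ p ∈ Finset.HasAntidiagonal.antidiagonal n,
        f p.1 / p.1.factorial * (g p.2 / p.2.factorial) := by
  rw [← Finset.powerset_univ, Finset.sum_powerset_apply_card (fun m => f m * g (n - m)),
    Finset.Nat.sum_antidiagonal_eq_sum_range_succ
      (fun i j => f i / i.factorial * (g j / j.factorial)), Finset.sum_div, Finset.card_univ,
    Fintype.card_fin]
  refine Finset.sum_congr rfl fun i hi => ?_
  have hi : i ≤ n := by simpa [Nat.lt_succ_iff] using hi
  have h := Nat.choose_mul_factorial_mul_factorial hi
  have h1 : ((n.choose i : ℕ) : ℝ≥0) * i.factorial * (n - i).factorial = n.factorial := by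
    exact_mod_cast h
  have h2 : ((i.factorial : ℕ) : ℝ≥0) ≠ 0 := by exact_mod_cast i.factorial_ne_zero
  have h3 : (((n - i).factorial : ℕ) : ℝ≥0) ≠ 0 := by exact_mod_cast (n - i).factorial_ne_zero
  have h4 : ((n.factorial : ℕ) : ℝ≥0) ≠ 0 := by exact_mod_cast n.factorial_ne_zero
  rw [nsmul_eq_mul, div_mul_div_comm, div_eq_div_iff h4 (mul_ne_zero h2 h3), ← h1]
  ring

theorem card_notMem {n : ℕ} (S : Finset (Fin n)) : Fintype.card {v // v ∉ S} = n - S.card := by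
  simp [Fintype.card_subtype_compl]

theorem succ_mul_branchCoeff_inner (y : ℝ≥0) (k l n : ℕ) :
    (k + 1) * branchCoeff y (k + 1) l n =
      ∑ p ∈ Finset.HasAntidiagonal.antidiagonal n, innerCoeff y p.1 * branchCoeff y k l p.2 := by
  simp only [innerCoeff, branchCoeff]
  rw [← sum_finset_div_factorial (fun m => innerSum y (Fin m)) (fun m => branchSum y k l (Fin m)),
    ← mul_div_assoc, succ_mul_branchSum_inner]
  congr 1
  refine Finset.sum_congr rfl fun S _ => ?_
  rw [innerSum_congr y (Fintype.equivFinOfCardEq (Fintype.card_coe S))]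
  exact congrArg _ (@branchSum_congr _ _ (_) (_) y k l (Fintype.equivFinOfCardEq (card_notMem S)))

theorem succ_mul_branchCoeff_leaf (y : ℝ≥0) (k l n : ℕ) :
    (l + 1) * branchCoeff y k (l + 1) n =
      ∑ p ∈ Finset.HasAntidiagonal.antidiagonal n,
        (if p.1 = 1 then y else 0) * branchCoeff y k l p.2 := by
  have h : ∀ m : ℕ, (if m = 1 then y else 0) = leafSum y (Fin m) / m.factorial := fun m => by
    rw [leafSum_fin]
    split_ifs with hm <;> simp [hm]
  simp only [branchCoeff, h]
  rw [← sum_finset_div_factorial (fun m => leafSum y (Fin m)) (fun m => branchSum y k l (Fin m)),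
    ← mul_div_assoc, succ_mul_branchSum_leaf]
  congr 1
  refine Finset.sum_congr rfl fun S _ => ?_
  rw [leafSum_congr y (Fintype.equivFinOfCardEq (Fintype.card_coe S))]
  exact congrArg _ (@branchSum_congr _ _ (_) (_) y k l (Fintype.equivFinOfCardEq (card_notMem S)))

theorem branchCoeff_zero_zero (y : ℝ≥0) (n : ℕ) :
    branchCoeff y 0 0 n = if n = 1 then 1 else 0 := by
  rw [branchCoeff, branchSum_zero_zero_fin]
  split_ifs with h <;> simp [h]

theorem branchCoeff_zero_right (y : ℝ≥0) (k l : ℕ) : branchCoeff y k l 0 = 0 := by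
  simp [branchCoeff, branchSum]

open scoped ENNReal in
theorem innerCoeff_eq_tsum (y : ℝ≥0) (n : ℕ) :
    (innerCoeff y n : ℝ≥0∞) =
      ∑' p : ℕ × ℕ, (rootWt y p.1 p.2 : ℝ≥0∞) * branchCoeff y p.1 p.2 n := by
  simp only [innerCoeff, branchCoeff, div_eq_mul_inv, ENNReal.coe_mul, innerSum_eq_tsum,
    ← ENNReal.tsum_mul_right, mul_assoc]

theorem ndeg_eq_nbrCount {n : ℕ} (T : SimpleGraph (Fin n)) (v : Fin n) :
    ndeg T v = nbrCount T v := by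
  rw [ndeg, Set.ncard_eq_toFinset_card', nbrCount, Finset.sum_boole]
  simp only [Nat.cast_id]
  congr 1
  ext w
  simp

theorem mobDeg_eq_legDeg {n : ℕ} (T : SimpleGraph (Fin n)) (r v : Fin n) :
    mobDeg T r v = legDeg T r v := by
  by_cases h : v = r <;> simp [mobDeg, legDeg, ndeg_eq_nbrCount, h]

theorem isMobile_iff {n : ℕ} (T : SimpleGraph (Fin n)) (r : Fin n) :
    IsMobile T r ↔ T.IsTree ∧ ∀ v, legDeg T r v ≠ 2 := by
  have ht : MetricDimPaper.IsTree T ↔ T.IsTree := ⟨fun h => ⟨h.1, h.2⟩, fun h => ⟨h.1, h.2⟩⟩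
  rw [IsMobile, ht]
  refine and_congr_right fun _ => ?_
  simp only [ndeg_eq_nbrCount]
  constructor
  · rintro ⟨h1, h2⟩ v
    by_cases h : v = r
    · subst h
      simpa [legDeg] using h2
    · simpa [legDeg, h] using h1 v h
  · refine fun h => ⟨fun v hv => by simpa [legDeg, hv] using h v, ?_⟩
    simpa [legDeg] using h r

theorem fullWt_eq_zpow {n : ℕ} {y : ℝ≥0} (hy : y ≠ 0) {T : SimpleGraph (Fin n)} {r : Fin n}
    (h : ∀ v, legDeg T r v ≠ 2) :
    fullWt y T r = y ^ ((mobLeaves T r : ℤ) - (mobKCount T r : ℤ)) := by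
  have h1 : ∀ v, vertexWt y T r v = (if mobDeg T r v = 1 then y else 1) *
      (if mobDeg T r v ≠ 1 ∧ ∃ w, T.Adj v w ∧ mobDeg T r w = 1 then y⁻¹ else 1) := fun v => by
    simp only [vertexWt, mobDeg_eq_legDeg, h, if_false]
    by_cases hv : legDeg T r v = 1 <;> simp [hv]
  rw [zpow_sub₀ hy, zpow_natCast, zpow_natCast, div_eq_mul_inv, ← inv_pow, fullWt]
  simp only [h1, Finset.prod_mul_distrib, Finset.prod_ite, Finset.prod_const, one_pow, mul_one,
    mobLeaves, mobKCount, Nat.card_eq_fintype_card, Fintype.card_subtype]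

theorem mobileCoeff_eq {y : ℝ≥0} (hy : y ≠ 0) (n : ℕ) :
    mobileCoeff y n = (innerCoeff y n + if n = 1 then y else 0 : ℝ≥0) := by
  have hl : (if n = 1 then y else 0) = leafSum y (Fin n) / n.factorial := by
    rw [leafSum_fin]
    split_ifs with hm <;> simp [hm]
  rw [hl, innerCoeff, ← add_div, mobileCoeff, NNReal.coe_div, NNReal.coe_natCast]
  congr 1
  rw [innerSum, leafSum, ← Finset.sum_add_distrib, finsum_eq_sum_of_fintype,
    ← Finset.sum_subtype (Finset.univ.filter fun q : SimpleGraph (Fin n) × Fin n =>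
        IsMobile q.1 q.2)
      (by simp) fun q => (y : ℝ) ^ ((mobLeaves q.1 q.2 : ℤ) - (mobKCount q.1 q.2 : ℤ)),
    Finset.sum_filter, NNReal.coe_sum]
  refine Finset.sum_congr (by ext; simp) fun q _ => ?_
  by_cases hT : q.1.IsTree
  · by_cases h : ∀ v, legDeg q.1 q.2 v ≠ 2
    · rw [if_pos ((isMobile_iff _ _).2 ⟨hT, h⟩), fullWt_eq_zpow hy h]
      by_cases h1 : legDeg q.1 q.2 q.2 = 1 <;> simp [hT, h1]
    · rw [if_neg fun hm => h ((isMobile_iff _ _).1 hm).2]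
      push Not at h
      obtain ⟨v, hv⟩ := h
      have h0 : fullWt y q.1 q.2 = 0 :=
        Finset.prod_eq_zero (Finset.mem_univ v) (by simp [vertexWt, hv])
      simp [h0]
  · rw [if_neg fun hm => hT ((isMobile_iff _ _).1 hm).1]
    simp [hT]

end Combinatorics

section Series

open scoped NNReal ENNReal

/-- The fixed point map of the functional equation for the series of `innerCoeff`. -/
def innerMap (y r q : ℝ) : ℝ :=
  r * (Real.exp q * (1 + (Real.exp (y * r) - 1) / y) - 1 - q - r)

/-- The contribution to `innerMap y r q` of the roots with `p.1` neighbours that are not leaves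
and `p.2` neighbours that are leaves. -/
def branchTerm (y r q : ℝ≥0) (p : ℕ × ℕ) : ℝ≥0 :=
  rootWt y p.1 p.2 * (r * (q ^ p.1 / p.1.factorial) * ((y * r) ^ p.2 / p.2.factorial))

theorem coe_rootWt (y : ℝ≥0) (k l : ℕ) :
    (rootWt y k l : ℝ) = (y : ℝ)⁻¹ + (1 - (y : ℝ)⁻¹) * (if l = 0 then 1 else 0)
      - (if (k, l) = (0, 0) then 1 else 0) - (if (k, l) = (1, 0) then 1 else 0)
      - (y : ℝ)⁻¹ * (if (k, l) = (0, 1) then 1 else 0) := by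
  rcases k with _ | _ | k <;> rcases l with _ | _ | l <;> simp [rootWt]
  rw [if_neg (by lia), NNReal.coe_inv]

theorem hasSum_branchTerm {y : ℝ≥0} (hy : y ≠ 0) (r q : ℝ≥0) :
    HasSum (fun p => (branchTerm y r q p : ℝ)) (innerMap y r q) := by
  have hy' : (y : ℝ) ≠ 0 := by exact_mod_cast hy
  set a : ℕ → ℝ := fun k => (q : ℝ) ^ k / k.factorial with ha_def
  set b : ℕ → ℝ := fun l => ((y : ℝ) * r) ^ l / l.factorial with hb_def
  have ha : HasSum a (Real.exp q) := by
    rw [Real.exp_eq_exp_ℝ]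
    exact NormedSpace.expSeries_div_hasSum_exp (q : ℝ)
  have hb : HasSum b (Real.exp (y * r)) := by
    rw [Real.exp_eq_exp_ℝ]
    exact NormedSpace.expSeries_div_hasSum_exp ((y : ℝ) * r)
  have ha0 : 0 ≤ a := fun k => by positivity
  have hb0 : 0 ≤ b := fun k => by positivity
  have hc : HasSum (fun l : ℕ => if l = 0 then (1 : ℝ) else 0) 1 := hasSum_ite_eq 0 1
  have hc0 : 0 ≤ fun l : ℕ => if l = 0 then (1 : ℝ) else 0 := fun l => by
    dsimp; split_ifs <;> norm_num
  have h1 := (ha.mul hb (ha.summable.mul_of_nonneg hb.summable ha0 hb0)).mul_left (y : ℝ)⁻¹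
  have h2 := (ha.mul hc (ha.summable.mul_of_nonneg hc.summable ha0 hc0)).mul_left (1 - (y : ℝ)⁻¹)
  have h3 := hasSum_ite_eq ((0, 0) : ℕ × ℕ) (1 : ℝ)
  have h4 := hasSum_ite_eq ((1, 0) : ℕ × ℕ) (q : ℝ)
  have h5 := (hasSum_ite_eq ((0, 1) : ℕ × ℕ) ((y : ℝ) * r)).mul_left (y : ℝ)⁻¹
  have h := ((((h1.add h2).sub h3).sub h4).sub h5).mul_left (r : ℝ)
  convert! h using 1
  · funext ⟨k, l⟩
    simp only [branchTerm, NNReal.coe_mul, coe_rootWt, NNReal.coe_div, NNReal.coe_pow,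
      NNReal.coe_natCast]
    rcases k with _ | _ | k <;> rcases l with _ | _ | l <;> simp [a, b] <;> ring_nf <;> simp
  · rw [innerMap]
    field_simp
    ring

theorem tsum_branchTerm {y : ℝ≥0} (hy : y ≠ 0) (r q : ℝ≥0) :
    ∑' p, (branchTerm y r q p : ℝ≥0∞) = ENNReal.ofReal (innerMap y r q) := by
  have h := hasSum_branchTerm hy r q
  have h0 : 0 ≤ innerMap y r q := h.nonneg fun _ => NNReal.coe_nonneg _
  lift innerMap y r q to ℝ≥0 using h0 with c
  rw [ENNReal.ofReal_coe_nnreal]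
  exact (ENNReal.hasSum_coe.2 (NNReal.hasSum_coe.1 h)).tsum_eq

theorem tsum_sum_antidiagonal (f g : ℕ → ℝ≥0∞) :
    ∑' n, ∑ p ∈ Finset.HasAntidiagonal.antidiagonal n, f p.1 * g p.2 =
      (∑' n, f n) * ∑' n, g n := by
  rw [← ENNReal.tsum_mul_right]
  simp_rw [← ENNReal.tsum_mul_left]
  rw [← ENNReal.tsum_prod (f := fun a b => f a * g b),
    ← Finset.HasAntidiagonal.sigmaAntidiagonalEquivProd.tsum_eq, ENNReal.tsum_sigma']
  refine tsum_congr fun n => ?_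
  rw [tsum_fintype]
  exact (Finset.sum_coe_sort _ fun p : ℕ × ℕ => f p.1 * g p.2).symm

theorem sum_range_sum_antidiagonal_le (f g : ℕ → ℝ≥0) (hg : g 0 = 0) (N : ℕ) :
    ∑ n ∈ Finset.range (N + 1),
        ∑ p ∈ Finset.HasAntidiagonal.antidiagonal n, f p.1 * g p.2 ≤
      (∑ n ∈ Finset.range N, f n) * ∑ n ∈ Finset.range (N + 1), g n := by
  rw [Finset.sum_mul_sum, ← Finset.sum_product', Finset.sum_sigma',
    ← Finset.sum_filter_ne_zero]
  refine (Finset.sum_image (g := fun x : (_ : ℕ) × (ℕ × ℕ) => x.2)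
    (f := fun p => f p.1 * g p.2) ?_).symm.trans_le ?_
  · rintro ⟨m, p⟩ hx ⟨n, p'⟩ hy (rfl : p = p')
    simp only [Finset.coe_filter, Set.mem_ofPred_eq, Finset.mem_sigma,
      Finset.HasAntidiagonal.mem_antidiagonal] at hx hy
    rw [← hx.1.2, ← hy.1.2]
  · refine Finset.sum_le_sum_of_subset fun p hp => ?_
    simp only [Finset.mem_image, Finset.mem_filter, Finset.mem_sigma, Finset.mem_range,
      Finset.HasAntidiagonal.mem_antidiagonal] at hp
    obtain ⟨x, ⟨⟨h1, h2⟩, h3⟩, rfl⟩ := hp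
    have h4 : x.2.2 ≠ 0 := fun h => h3 (by rw [h, hg, mul_zero])
    simp only [Finset.mem_product, Finset.mem_range]
    lia

theorem sum_antidiagonal_mul_pow (f g : ℕ → ℝ≥0) (r : ℝ≥0) (n : ℕ) :
    (∑ p ∈ Finset.HasAntidiagonal.antidiagonal n, f p.1 * g p.2) * r ^ n =
      ∑ p ∈ Finset.HasAntidiagonal.antidiagonal n, (f p.1 * r ^ p.1) * (g p.2 * r ^ p.2) := by
  rw [Finset.sum_mul]
  refine Finset.sum_congr rfl fun p hp => ?_
  rw [← Finset.HasAntidiagonal.mem_antidiagonal.1 hp, pow_add]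
  ring

theorem tsum_ite_eq_one_mul_pow (c r : ℝ≥0) :
    ∑' n : ℕ, (((if n = 1 then c else 0) * r ^ n : ℝ≥0) : ℝ≥0∞) = (c * r : ℝ≥0) := by
  rw [tsum_eq_single 1 fun n hn => by simp [hn]]
  simp

theorem sum_ite_eq_one_mul_pow_le (c r : ℝ≥0) (N : ℕ) :
    ∑ n ∈ Finset.range N, (if n = 1 then c else 0) * r ^ n ≤ c * r := by
  simp only [ite_mul, zero_mul, Finset.sum_ite_eq']
  split_ifs <;> simp

theorem tsum_branchCoeff {y r q : ℝ≥0}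
    (hq : ∑' n, ((innerCoeff y n * r ^ n : ℝ≥0) : ℝ≥0∞) = q) (k l : ℕ) :
    ∑' n, ((branchCoeff y k l n * r ^ n : ℝ≥0) : ℝ≥0∞) =
      (r * (q ^ k / k.factorial) * ((y * r) ^ l / l.factorial) : ℝ≥0) := by
  induction k with
  | zero =>
    induction l with
    | zero => simpa only [branchCoeff_zero_zero, pow_zero, Nat.factorial_zero, Nat.cast_one,
        div_one, mul_one, one_mul] using tsum_ite_eq_one_mul_pow 1 r
    | succ l ih =>
      have h : ((l + 1 : ℝ≥0) : ℝ≥0∞) * ∑' n, ((branchCoeff y 0 (l + 1) n * r ^ n : ℝ≥0) : ℝ≥0∞) =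
          (y * r : ℝ≥0) * ∑' n, ((branchCoeff y 0 l n * r ^ n : ℝ≥0) : ℝ≥0∞) := by
        rw [← tsum_ite_eq_one_mul_pow, ← tsum_sum_antidiagonal, ← ENNReal.tsum_mul_left]
        refine tsum_congr fun n => ?_
        rw [← ENNReal.coe_mul, ← mul_assoc, succ_mul_branchCoeff_leaf,
          sum_antidiagonal_mul_pow (fun m => if m = 1 then y else 0)]
        push_cast
        rfl
      rw [ih, ← ENNReal.coe_mul] at h
      refine (ENNReal.mul_right_inj (a := ((l + 1 : ℝ≥0) : ℝ≥0∞)) (by simp) (by simp)).1 ?_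
      rw [h, ← ENNReal.coe_mul, ENNReal.coe_inj, Nat.factorial_succ]
      push_cast
      field_simp
      ring
  | succ k ih =>
    have h : ((k + 1 : ℝ≥0) : ℝ≥0∞) * ∑' n, ((branchCoeff y (k + 1) l n * r ^ n : ℝ≥0) : ℝ≥0∞) =
        q * ∑' n, ((branchCoeff y k l n * r ^ n : ℝ≥0) : ℝ≥0∞) := by
      rw [← hq, ← tsum_sum_antidiagonal, ← ENNReal.tsum_mul_left]
      refine tsum_congr fun n => ?_
      rw [← ENNReal.coe_mul, ← mul_assoc, succ_mul_branchCoeff_inner, sum_antidiagonal_mul_pow]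
      push_cast
      rfl
    rw [ih, ← ENNReal.coe_mul] at h
    refine (ENNReal.mul_right_inj (a := ((k + 1 : ℝ≥0) : ℝ≥0∞)) (by simp) (by simp)).1 ?_
    rw [h, ← ENNReal.coe_mul, ENNReal.coe_inj, Nat.factorial_succ]
    push_cast
    field_simp
    ring

theorem sum_branchCoeff_le {y r q : ℝ≥0} {N : ℕ}
    (hq : ∑ n ∈ Finset.range N, innerCoeff y n * r ^ n ≤ q) (k l : ℕ) :
    ∑ n ∈ Finset.range (N + 1), branchCoeff y k l n * r ^ n ≤
      r * (q ^ k / k.factorial) * ((y * r) ^ l / l.factorial) := by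
  induction k with
  | zero =>
    induction l with
    | zero => simpa [branchCoeff_zero_zero, -ite_mul] using sum_ite_eq_one_mul_pow_le 1 r (N + 1)
    | succ l ih =>
      have h : (l + 1 : ℝ≥0) * ∑ n ∈ Finset.range (N + 1), branchCoeff y 0 (l + 1) n * r ^ n ≤
          y * r * (r * (q ^ 0 / (Nat.factorial 0)) * ((y * r) ^ l / l.factorial)) := by
        refine le_trans ?_ (mul_le_mul' (sum_ite_eq_one_mul_pow_le y r N) ih)
        refine le_trans (le_of_eq ?_)
          (sum_range_sum_antidiagonal_le _ _ (by simp [branchCoeff_zero_right]) N)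
        rw [Finset.mul_sum]
        refine Finset.sum_congr rfl fun n _ => ?_
        rw [← mul_assoc, succ_mul_branchCoeff_leaf,
          sum_antidiagonal_mul_pow (fun m => if m = 1 then y else 0)]
      refine le_of_mul_le_mul_left (h.trans_eq ?_) (by positivity : (0 : ℝ≥0) < l + 1)
      rw [Nat.factorial_succ]
      push_cast
      field_simp
      ring
  | succ k ih =>
    have h : (k + 1 : ℝ≥0) * ∑ n ∈ Finset.range (N + 1), branchCoeff y (k + 1) l n * r ^ n ≤
        q * (r * (q ^ k / k.factorial) * ((y * r) ^ l / l.factorial)) := by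
      refine le_trans ?_ (mul_le_mul' hq ih)
      refine le_trans (le_of_eq ?_)
        (sum_range_sum_antidiagonal_le _ _ (by simp [branchCoeff_zero_right]) N)
      rw [Finset.mul_sum]
      refine Finset.sum_congr rfl fun n _ => ?_
      rw [← mul_assoc, succ_mul_branchCoeff_inner, sum_antidiagonal_mul_pow]
    refine le_of_mul_le_mul_left (h.trans_eq ?_) (by positivity : (0 : ℝ≥0) < k + 1)
    rw [Nat.factorial_succ]
    push_cast
    field_simp
    ring

theorem innerMap_tsum_innerCoeff {y r : ℝ≥0} (hy : y ≠ 0)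
    (h : Summable fun n => innerCoeff y n * r ^ n) :
    innerMap y r (∑' n, innerCoeff y n * r ^ n : ℝ≥0) = (∑' n, innerCoeff y n * r ^ n : ℝ≥0) := by
  set q := ∑' n, innerCoeff y n * r ^ n with hq_def
  have hq : ∑' n, ((innerCoeff y n * r ^ n : ℝ≥0) : ℝ≥0∞) = q := (ENNReal.coe_tsum h).symm
  have h1 : (q : ℝ≥0∞) = ENNReal.ofReal (innerMap y r q) := by
    rw [← tsum_branchTerm hy, ← hq]
    simp only [ENNReal.coe_mul, innerCoeff_eq_tsum, ← ENNReal.tsum_mul_right]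
    rw [ENNReal.tsum_comm]
    refine tsum_congr fun p => ?_
    simp only [branchTerm, mul_assoc]
    rw [ENNReal.tsum_mul_left, ENNReal.coe_mul]
    congr 1
    rw [← mul_assoc, ← tsum_branchCoeff hq]
    simp
  have h0 : 0 ≤ innerMap y r q := (hasSum_branchTerm hy r q).nonneg fun _ => NNReal.coe_nonneg _
  have h2 := congrArg ENNReal.toReal h1
  rw [ENNReal.toReal_ofReal h0] at h2
  exact h2.symm

theorem summable_innerCoeff {y r q : ℝ≥0} (hy : y ≠ 0) (hq : innerMap y r q ≤ q) :
    Summable fun n => innerCoeff y n * r ^ n := by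
  have h : ∀ N, ∑ n ∈ Finset.range N, innerCoeff y n * r ^ n ≤ q := fun N => by
    induction N with
    | zero => simp
    | succ N ih =>
      rw [← ENNReal.coe_le_coe]
      calc ((∑ n ∈ Finset.range (N + 1), innerCoeff y n * r ^ n : ℝ≥0) : ℝ≥0∞)
          = ∑' p : ℕ × ℕ, ((rootWt y p.1 p.2 *
              ∑ n ∈ Finset.range (N + 1), branchCoeff y p.1 p.2 n * r ^ n : ℝ≥0) : ℝ≥0∞) := by
            simp only [ENNReal.ofNNReal_finsetSum, ENNReal.coe_mul, innerCoeff_eq_tsum,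
              ← ENNReal.tsum_mul_right, Finset.mul_sum, mul_assoc]
            rw [Summable.tsum_finsetSum fun _ _ => ENNReal.summable]
        _ ≤ ∑' p, (branchTerm y r q p : ℝ≥0∞) := by
            refine ENNReal.tsum_le_tsum fun p => ENNReal.coe_le_coe.2 ?_
            exact mul_le_mul' le_rfl (sum_branchCoeff_le ih p.1 p.2)
        _ ≤ q := by
            rw [tsum_branchTerm hy, ← ENNReal.ofReal_coe_nnreal]
            exact ENNReal.ofReal_le_ofReal hq
  exact NNReal.summable_of_sum_range_le h

theorem summable_mobileCoeff_iff {y : ℝ≥0} (hy : y ≠ 0) (r : ℝ≥0) :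
    (Summable fun n : ℕ => |mobileCoeff y n| * (r : ℝ) ^ n) ↔
      Summable fun n => innerCoeff y n * r ^ n := by
  have h1 : Summable fun n : ℕ => (if n = 1 then y else 0) * r ^ n :=
    summable_of_hasFiniteSupport ((Set.finite_singleton 1).subset fun n hn => by
      by_contra h
      exact hn (by simp [show n ≠ 1 from h]))
  have h2 : (fun n : ℕ => |mobileCoeff y n| * (r : ℝ) ^ n) =
      fun n => ((innerCoeff y n * r ^ n + (if n = 1 then y else 0) * r ^ n : ℝ≥0) : ℝ) := by
    funext n
    rw [mobileCoeff_eq hy, NNReal.abs_eq, ← add_mul, NNReal.coe_mul, NNReal.coe_pow]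
  rw [h2, NNReal.summable_coe]
  refine ⟨fun h => NNReal.summable_of_le (fun n => ?_) h, fun h => h.add h1⟩
  exact le_self_add

end Series

section Radius

theorem strictMonoOn_div_mul_exp {δ : ℝ} (hδ : |δ| ≤ 1 / 4) :
    StrictMonoOn (fun x : ℝ => x / (1 + x) * (δ * Real.exp (-x) + Real.exp (δ * x)))
      (Set.Icc 0 1) := by
  obtain ⟨h1, h2⟩ := abs_le.1 hδ
  have hd : ∀ x : ℝ, 0 ≤ x → HasDerivAt
      (fun x : ℝ => x / (1 + x) * (δ * Real.exp (-x) + Real.exp (δ * x)))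
      ((1 * (1 + x) - x * 1) / (1 + x) ^ 2 * (δ * Real.exp (-x) + Real.exp (δ * x)) +
        x / (1 + x) * (δ * (Real.exp (-x) * -1) + Real.exp (δ * x) * (δ * 1))) x := fun x hx => by
    have hx' : 1 + x ≠ 0 := by positivity
    exact ((hasDerivAt_id x).div ((hasDerivAt_id x).const_add 1) hx').mul
      (((hasDerivAt_neg x).exp.const_mul δ).add (((hasDerivAt_id x).const_mul δ).exp))
  refine strictMonoOn_of_deriv_pos (convex_Icc 0 1)
    (fun x hx => (hd x hx.1).continuousAt.continuousWithinAt) fun x hx => ?_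
  rw [interior_Icc] at hx
  obtain ⟨hx0, hx1⟩ := hx
  rw [(hd x hx0.le).deriv]
  have he : 3 / 4 ≤ Real.exp (δ * x) := by
    have := Real.add_one_le_exp (δ * x)
    nlinarith
  have hc : 1 / 2 ≤ 1 + x * (1 + x) * δ := by nlinarith [mul_pos hx0 (by linarith : 0 < 1 + x)]
  have hn0 : 0 < Real.exp (-x) := Real.exp_pos _
  have hn1 : Real.exp (-x) ≤ 1 := Real.exp_le_one_iff.2 (by linarith)
  have hp : |1 - x * (1 + x)| ≤ 1 := abs_le.2 ⟨by nlinarith, by nlinarith⟩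
  have hm : |δ * Real.exp (-x) * (1 - x * (1 + x))| ≤ 1 / 4 * 1 * 1 := by
    rw [abs_mul, abs_mul, abs_of_pos hn0]
    gcongr
  have hm' := (abs_le.1 hm).1
  have hpos : 0 < Real.exp (δ * x) * (1 + x * (1 + x) * δ) +
      δ * Real.exp (-x) * (1 - x * (1 + x)) := by nlinarith
  have hfac : (1 * (1 + x) - x * 1) / (1 + x) ^ 2 * (δ * Real.exp (-x) + Real.exp (δ * x)) +
        x / (1 + x) * (δ * (Real.exp (-x) * -1) + Real.exp (δ * x) * (δ * 1)) =
      (Real.exp (δ * x) * (1 + x * (1 + x) * δ) +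
        δ * Real.exp (-x) * (1 - x * (1 + x))) / (1 + x) ^ 2 := by
    field_simp
    ring
  rw [hfac]
  positivity

theorem mul_exp_eq {y x : ℝ} (hy : 0 < y) (hx : 0 ≤ x) :
    (1 + (Real.exp (y * x) - 1) / y) * x * Real.exp (1 - x) = Real.exp 1 / y * (1 + x) *
      (x / (1 + x) * ((y - 1) * Real.exp (-x) + Real.exp ((y - 1) * x))) := by
  have h1 : Real.exp (1 - x) = Real.exp 1 * Real.exp (-x) := by
    rw [← Real.exp_add, sub_eq_add_neg]
  have h2 : Real.exp ((y - 1) * x) = Real.exp (y * x) * Real.exp (-x) := by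
    rw [← Real.exp_add]
    ring_nf
  have h3 : 1 + x ≠ 0 := by positivity
  rw [h1, h2]
  field_simp
  ring

theorem mul_exp_lt_of_lt {y x z : ℝ} (hy : 0 < y) (hy1 : |y - 1| ≤ 1 / 4) (hx : 0 ≤ x)
    (hxz : x < z) (hz : z ≤ 1) :
    (1 + z) * ((1 + (Real.exp (y * x) - 1) / y) * x * Real.exp (1 - x)) <
      (1 + x) * ((1 + (Real.exp (y * z) - 1) / y) * z * Real.exp (1 - z)) := by
  have hz0 : 0 < z := hx.trans_lt hxz
  rw [mul_exp_eq hy hx, mul_exp_eq hy hz0.le]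
  have h := strictMonoOn_div_mul_exp hy1 ⟨hx, hxz.le.trans hz⟩ ⟨hz0.le, hz⟩ hxz
  have hc : 0 < Real.exp 1 / y * (1 + x) * (1 + z) := by positivity
  have := mul_lt_mul_of_pos_left h hc
  dsimp only at this
  linarith

theorem exists_innerMap_le {y r : ℝ} (hy : 0 < y) (hr0 : 0 ≤ r) (hr1 : r ≤ 1)
    (h : (1 + (Real.exp (y * r) - 1) / y) * r * Real.exp (1 - r) < 1 + r) :
    ∃ q, 0 ≤ q ∧ innerMap y r q ≤ q := by
  rcases hr0.eq_or_lt with rfl | hr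
  · exact ⟨0, le_rfl, by simp [innerMap]⟩
  have hA : 0 < 1 + (Real.exp (y * r) - 1) / y := by
    have : 0 ≤ Real.exp (y * r) - 1 := sub_nonneg.2 (Real.one_le_exp (by positivity))
    positivity
  unfold innerMap
  set A := 1 + (Real.exp (y * r) - 1) / y
  have hq : 1 - r ≤ Real.log ((1 + r) / (A * r)) := by
    rw [Real.le_log_iff_exp_le (by positivity), le_div_iff₀ (by positivity)]
    linarith
  refine ⟨Real.log ((1 + r) / (A * r)), by linarith, ?_⟩
  rw [Real.exp_log (by positivity)]
  have : (1 + r) / (A * r) * A = (1 + r) / r := by field_simp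
  rw [this]
  have : r * ((1 + r) / r - 1 - Real.log ((1 + r) / (A * r)) - r) =
      1 - r ^ 2 - r * Real.log ((1 + r) / (A * r)) := by
    field_simp
    ring
  rw [this]
  nlinarith

theorem lt_innerMap {y r q : ℝ} (hr : 0 < r) (hq : 0 ≤ q)
    (h : 1 + r < (1 + (Real.exp (y * r) - 1) / y) * r * Real.exp (1 - r)) :
    q < innerMap y r q := by
  unfold innerMap
  set A := 1 + (Real.exp (y * r) - 1) / y
  have he : Real.exp (1 - r) * (q + r) ≤ Real.exp q := by
    have h1 := Real.add_one_le_exp (q - (1 - r))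
    have h2 : Real.exp q = Real.exp (1 - r) * Real.exp (q - (1 - r)) := by
      rw [← Real.exp_add]
      ring_nf
    rw [h2]
    exact mul_le_mul_of_nonneg_left (by linarith) (Real.exp_pos _).le
  have hA : 0 < A * r := by
    by_contra hA
    nlinarith [Real.exp_pos (1 - r)]
  have h3 := mul_le_mul_of_nonneg_left he hA.le
  have h4 := mul_lt_mul_of_pos_right h (by linarith : 0 < q + r)
  nlinarith

theorem summable_mobileCoeff_of_lt {y ρ r : ℝ} (hy : 0 < y) (hy1 : |y - 1| ≤ 1 / 4)
    (hρ1 : ρ < 1)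
    (hρ : 1 + ρ = (1 + (Real.exp (y * ρ) - 1) / y) * ρ * Real.exp (1 - ρ))
    (hr0 : 0 ≤ r) (hr : r < ρ) : Summable fun n : ℕ => |mobileCoeff y n| * r ^ n := by
  have h := mul_exp_lt_of_lt hy hy1 hr0 hr hρ1.le
  rw [← hρ, mul_comm (1 + r)] at h
  obtain ⟨q, hq0, hq⟩ := exists_innerMap_le hy hr0 (hr.trans hρ1).le
    (lt_of_mul_lt_mul_left h (by linarith))
  lift y to NNReal using hy.le
  lift r to NNReal using hr0
  lift q to NNReal using hq0
  have hy0 : y ≠ 0 := by exact_mod_cast hy.ne'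
  exact (summable_mobileCoeff_iff hy0 r).2 (summable_innerCoeff hy0 hq)

theorem not_summable_mobileCoeff_of_lt {y ρ r : ℝ} (hy : 0 < y) (hy1 : |y - 1| ≤ 1 / 4)
    (hρ0 : 0 < ρ) (hρ1 : ρ < 1)
    (hρ : 1 + ρ = (1 + (Real.exp (y * ρ) - 1) / y) * ρ * Real.exp (1 - ρ))
    (hr : ρ < r) : ¬ Summable fun n : ℕ => |mobileCoeff y n| * r ^ n := by
  intro hs
  have hs' : Summable fun n : ℕ => |mobileCoeff y n| * (min r 1) ^ n := by
    have h0 : 0 ≤ min r 1 := le_min (hρ0.trans hr).le zero_le_one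
    refine hs.of_nonneg_of_le (fun n => by positivity) fun n => ?_
    gcongr
    exact min_le_left _ _
  have hlt : ρ < min r 1 := lt_min hr hρ1
  have hle : min r 1 ≤ 1 := min_le_right _ _
  generalize min r 1 = s at hs' hlt hle
  have hs0 : 0 < s := hρ0.trans hlt
  have h := mul_exp_lt_of_lt hy hy1 hρ0.le hlt hle
  rw [← hρ, mul_comm (1 + s)] at h
  have h' := lt_of_mul_lt_mul_left h (by linarith)
  lift y to NNReal using hy.le
  lift s to NNReal using hs0.le
  have hy0 : y ≠ 0 := by exact_mod_cast hy.ne'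
  have hQ := innerMap_tsum_innerCoeff hy0 ((summable_mobileCoeff_iff hy0 s).1 hs')
  exact (lt_innerMap hs0 (NNReal.coe_nonneg _) h').ne' hQ

end Radius

/-- for real `y` close enough to `1`, the radius of convergence of the power
series `P(·,y)` equals `ρ(y)`; the radius is characterized by (absolute) summability of
`aₙ rⁿ` for `r` below it and non-summability above it. -/
theorem mobile_gf_radius (ρ : ℝ → ℝ) (hρan : AnalyticAt ℝ ρ 1)
    (hρ1 : ρ 1 = 1 / (Real.exp 1 - 1))
    (hρeq : ∀ᶠ y in 𝓝 (1 : ℝ),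
      1 + ρ y = (1 + (Real.exp (y * ρ y) - 1) / y) * ρ y * Real.exp (1 - ρ y)) :
    ∃ ε : ℝ, 0 < ε ∧ ∀ y : ℝ, 0 < y → |y - 1| < ε → ∀ r : ℝ, 0 ≤ r →
      (r < ρ y → Summable fun n : ℕ => |mobileCoeff y n| * r ^ n) ∧
      (ρ y < r → ¬ Summable fun n : ℕ => |mobileCoeff y n| * r ^ n) := by
  have he : 2 < Real.exp 1 := by linarith [Real.exp_one_gt_d9]
  have h0 : ∀ᶠ y in 𝓝 (1 : ℝ), 0 < ρ y :=
    hρan.continuousAt.eventually_const_lt (by rw [hρ1]; exact one_div_pos.2 (by linarith))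
  have h1 : ∀ᶠ y in 𝓝 (1 : ℝ), ρ y < 1 :=
    hρan.continuousAt.eventually_lt_const
      (by rw [hρ1, div_lt_one (by linarith)]; linarith)
  obtain ⟨ε, hε, h⟩ := Metric.eventually_nhds_iff.1 (hρeq.and (h0.and h1))
  refine ⟨min ε (1 / 4), lt_min hε (by norm_num), fun y hy hy1 r hr => ?_⟩
  obtain ⟨hρ, hρ0, hρ1⟩ := h (show dist y 1 < ε from hy1.trans_le (min_le_left _ _))
  have hy2 : |y - 1| ≤ 1 / 4 := hy1.le.trans (min_le_right _ _)
  exact ⟨summable_mobileCoeff_of_lt hy hy2 hρ1 hρ hr,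
    not_summable_mobileCoeff_of_lt hy hy2 hρ0 hρ1 hρ⟩

end MetricDimPaper
end
end
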